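/- arXiv:2603.09355 — 2 statements merged into one kernel-verified Lean document; each statement's English description precedes it below -/
import Mathlib

section
/- SNAG as a discretization of the HNAG flow (reparametrization equivalence). Let x, x', v, v', g ∈ E (here x' and v' denote the next iterates x_{k+1}, v_{k+1}), and let α > 0, β ∈ ℝ, μ ≥ 0, γ > 0 be parameters. Define α̂ := 1/(1 + α), s := αβ, β̂ := 1/(1 + αμ/γ), and η := β̂·(α/γ). Then the SNAG update equations x' = α̂·x + (1 − α̂)·v' − α̂·s·g and v' = β̂·v + (1 − β̂)·x − η·g hold if and only if the HNAG-discretization equations (x' − x)/α = v' − x' − β·g and (v' − v)/α = (μ/γ)·(x − v') − (1/γ)·g hold. -/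
/-- Two equations are equivalent when their differences are proportional by a nonzero scalar. -/
theorem eq_iff_eq_of_sub_eq_smul_sub {E : Type*} [AddCommGroup E] [Module ℝ E]
    {a b p q : E} {c : ℝ} (hc : c ≠ 0) (h : a - b = c • (p - q)) : a = b ↔ p = q := by
  rw [← sub_eq_zero, h, smul_eq_zero_iff_right hc, sub_eq_zero]

/-- **SNAG as a discretization of the HNAG flow (reparametrization equivalence).**
Let `x, x', v, v', g ∈ E` (here `x'` and `v'` denote the next iterates `x_{k+1}`,
`v_{k+1}`), and let `α > 0`, `β ∈ ℝ`, `μ ≥ 0`, `γ > 0` be parameters.  Define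
`α̂ := 1/(1+α)`, `s := αβ`, `β̂ := 1/(1 + αμ/γ)` and `η := β̂·(α/γ)`.  Then the SNAG
update equations `x' = α̂x + (1−α̂)v' − α̂sg` and `v' = β̂v + (1−β̂)x − ηg` hold if and
only if the HNAG-discretization equations `(x'−x)/α = v' − x' − βg` and
`(v'−v)/α = (μ/γ)(x − v') − (1/γ)g` hold. -/
theorem snag_hnag_reparametrization
    {E : Type*} [NormedAddCommGroup E] [InnerProductSpace ℝ E]
    [FiniteDimensional ℝ E]
    (x x' v v' g : E) (α β μ γ : ℝ)
    (hα : 0 < α) (hμ : 0 ≤ μ) (hγ : 0 < γ)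
    (αhat s βhat η : ℝ)
    (hαhat : αhat = 1 / (1 + α))
    (hs : s = α * β)
    (hβhat : βhat = 1 / (1 + α * μ / γ))
    (hη : η = βhat * (α / γ)) :
    (x' = αhat • x + (1 - αhat) • v' - (αhat * s) • g ∧
        v' = βhat • v + (1 - βhat) • x - η • g) ↔
      (α⁻¹ • (x' - x) = v' - x' - β • g ∧
        α⁻¹ • (v' - v) = (μ / γ) • (x - v') - γ⁻¹ • g) := by
  have h₁ : 0 < 1 + α := by positivity
  have h₂ : 0 < γ + α * μ := by positivity
  have hβ : βhat = γ / (γ + α * μ) := by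
    rw [hβhat]
    field_simp
  subst hη hβ hs hαhat
  refine and_congr
    (eq_iff_eq_of_sub_eq_smul_sub (c := α / (1 + α)) (by positivity) ?_)
    (eq_iff_eq_of_sub_eq_smul_sub (c := α * (γ / (γ + α * μ))) (by positivity) ?_)
  all_goals
    match_scalars <;> field_simp <;> ring
end

section
/- Equivalence of the first-order HNAG system with the second-order Hessian-driven ODE. Let f : E → ℝ be twice continuously differentiable, let β > 0 and μ ≥ 0 be constants, and let x, v : ℝ → E and γ : ℝ → ℝ be differentiable functions with γ(t) ≠ 0 for all t, satisfying for all t: x'(t) = v(t) − x(t) − β∇f(x(t)), v'(t) = (μ/γ(t))·(x(t) − v(t)) − (1/γ(t))·∇f(x(t)), and γ'(t) = μ − γ(t). Then x is twice differentiable and satisfies for all t the second-order HNAG equation γ(t)·x''(t) + (γ(t) + μ)·x'(t) + β·γ(t)·(∇²f(x(t)))(x'(t)) + (1 + μβ)·∇f(x(t)) = 0, where ∇²f(x) denotes the Hessian of f at x acting as a linear map on E. -/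
/-- The gradient of a `C^(n+1)` function is `C^n`. -/
theorem ContDiff.gradient_of_succ {E : Type*} [NormedAddCommGroup E] [InnerProductSpace ℝ E]
    [CompleteSpace E] {f : E → ℝ} {n : WithTop ℕ∞} (hf : ContDiff ℝ (n + 1) f) :
    ContDiff ℝ n (gradient f) :=
  (InnerProductSpace.toDual ℝ E).symm.contDiff.comp (hf.fderiv_right le_rfl)

/-- **Equivalence of the first-order HNAG system with the second-order Hessian-driven
ODE.**  Let `f : E → ℝ` be twice continuously differentiable, `β > 0`, `μ ≥ 0`, and let
`x, v : ℝ → E`, `γ : ℝ → ℝ` be differentiable with `γ t ≠ 0` for all `t`, satisfying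
`x' = v − x − β∇f(x)`, `v' = (μ/γ)(x − v) − (1/γ)∇f(x)` and `γ' = μ − γ`.
Then `x` is twice differentiable and satisfies the second-order HNAG equation
`γx'' + (γ + μ)x' + βγ(∇²f(x))(x') + (1 + μβ)∇f(x) = 0`, where `∇²f(x)` is the Hessian
of `f` at `x` acting as a (continuous) linear map on `E`, i.e. the derivative of the
gradient map. -/
theorem hnag_first_order_second_order
    {E : Type*} [NormedAddCommGroup E] [InnerProductSpace ℝ E]
    [FiniteDimensional ℝ E]
    (f : E → ℝ) (hf : ContDiff ℝ 2 f)
    (β μ : ℝ) (hβ : 0 < β) (hμ : 0 ≤ μ)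
    (x v : ℝ → E) (γ : ℝ → ℝ)
    (hγne : ∀ t, γ t ≠ 0)
    (hx : ∀ t, HasDerivAt x (v t - x t - β • gradient f (x t)) t)
    (hv : ∀ t, HasDerivAt v ((μ / γ t) • (x t - v t) - (γ t)⁻¹ • gradient f (x t)) t)
    (hγ : ∀ t, HasDerivAt γ (μ - γ t) t) :
    (∀ t, DifferentiableAt ℝ (deriv x) t) ∧
      ∀ t : ℝ,
        γ t • deriv (deriv x) t + (γ t + μ) • deriv x t
          + (β * γ t) • (fderiv ℝ (gradient f) (x t)) (deriv x t)
          + (1 + μ * β) • gradient f (x t) = 0 := by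
  have hgrad : Differentiable ℝ (gradient f) :=
    (ContDiff.gradient_of_succ (n := 1) (by rwa [one_add_one_eq_two])).differentiable one_ne_zero
  have hdx : deriv x = fun t => v t - x t - β • gradient f (x t) :=
    funext fun t => (hx t).deriv
  have hddx : ∀ t, HasDerivAt (deriv x)
      ((μ / γ t) • (x t - v t) - (γ t)⁻¹ • gradient f (x t) - deriv x t
        - β • (fderiv ℝ (gradient f) (x t)) (deriv x t)) t := fun t => by
    have hxt : HasDerivAt x (deriv x t) t := (hx t).differentiableAt.hasDerivAt
    have hg : HasDerivAt (fun s => gradient f (x s))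
        ((fderiv ℝ (gradient f) (x t)) (deriv x t)) t :=
      (hgrad (x t)).hasFDerivAt.comp_hasDerivAt t hxt
    have h := ((hv t).sub hxt).sub (hg.const_smul β)
    refine h.congr_of_eventuallyEq (Filter.Eventually.of_forall fun s => ?_)
    exact congrFun hdx s
  refine ⟨fun t => (hddx t).differentiableAt, fun t => ?_⟩
  rw [(hddx t).deriv]
  generalize hH : (fderiv ℝ (gradient f) (x t)) (deriv x t) = H
  rw [(hx t).deriv]
  have hγt := hγne t
  match_scalars <;> field_simp <;> ring
end
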